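/- Let (X_t)_{t≥1} be a strictly stationary and temperately dependent sequence of real random variables with common continuous marginal cdf F, and let a_X = sup{x : F(x)=0}, b_X = inf{x : F(x)=1}. If h_0 is absolutely continuous on [a_X, b_X] with Radon–Nikodym derivative h_0* satisfying ∫_{a_X}^{b_X} |h_0*(x)| dx < ∞, then h_0(max_{1≤t≤n} X_t) − h_0(min_{1≤t≤n} X_t) converges in probability, as n → ∞, to ∫_{a_X}^{b_X} h_0*(x) dx (which equals h_0(b_X) − h_0(a_X) when the endpoints are finite). -/

import Mathlib

open MeasureTheory ProbabilityTheory Filter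

/-- The maximum of `X 1, …, X n`. -/
noncomputable def rmax {Ω : Type*} (X : ℕ → Ω → ℝ) (n : ℕ) (ω : Ω) : ℝ :=
  (Finset.Icc 1 (max n 1)).sup' (Finset.nonempty_Icc.mpr (le_max_right n 1)) fun t => X t ω

/-- The minimum of `X 1, …, X n`. -/
noncomputable def rmin {Ω : Type*} (X : ℕ → Ω → ℝ) (n : ℕ) (ω : Ω) : ℝ :=
  (Finset.Icc 1 (max n 1)).inf' (Finset.nonempty_Icc.mpr (le_max_right n 1)) fun t => X t ω

/-- The cumulative distribution function of a random variable `X` under `P`. -/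
noncomputable def cdfOf {Ω : Type*} [MeasurableSpace Ω] (P : Measure Ω) (X : Ω → ℝ) : ℝ → ℝ :=
  fun x => (P {ω | X ω ≤ x}).toReal

/-- Lower endpoint `a_X = sup {x : F x = 0}` of the support of a cdf `F`. -/
noncomputable def lowerEnd (F : ℝ → ℝ) : EReal :=
  sSup ((fun x : ℝ => (x : EReal)) '' {x | F x = 0})

/-- Upper endpoint `b_X = inf {x : F x = 1}` of the support of a cdf `F`. -/
noncomputable def upperEnd (F : ℝ → ℝ) : EReal :=
  sInf ((fun x : ℝ => (x : EReal)) '' {x | F x = 1})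

/-- Strict stationarity of the sequence `X 1, X 2, …` : for every `k` and `t`,
`(X (1+t), …, X (k+t))` has the same distribution as `(X 1, …, X k)`. -/
def StrictlyStationary {Ω : Type*} [MeasurableSpace Ω] (P : Measure Ω)
    (X : ℕ → Ω → ℝ) : Prop :=
  ∀ (k t : ℕ),
    Measure.map (fun ω => fun i : Fin k => X (1 + t + (i : ℕ)) ω) P =
      Measure.map (fun ω => fun i : Fin k => X (1 + (i : ℕ)) ω) P

/-- Temperate dependence: for every `x` strictly inside the support of `F`,
`P(min_{1≤t≤n} X_t ≥ x) → 0` and `P(max_{1≤t≤n} X_t ≤ x) → 0`. -/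
def TemperatelyDependent {Ω : Type*} [MeasurableSpace Ω] (P : Measure Ω)
    (X : ℕ → Ω → ℝ) (F : ℝ → ℝ) : Prop :=
  ∀ x : ℝ, lowerEnd F < (x : EReal) → (x : EReal) < upperEnd F →
    Tendsto (fun n => P {ω | x ≤ rmin X n ω}) atTop (nhds 0) ∧
    Tendsto (fun n => P {ω | rmax X n ω ≤ x}) atTop (nhds 0)

/-- Convergence in probability of `Z n` to the constant `c`. -/
def TendstoInProb {Ω : Type*} [MeasurableSpace Ω] (P : Measure Ω)
    (Z : ℕ → Ω → ℝ) (c : ℝ) : Prop :=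
  ∀ ε : ℝ, 0 < ε → Tendsto (fun n => P {ω | ε ≤ |Z n ω - c|}) atTop (nhds 0)

lemma aux_mono {Ω : Type*} [MeasurableSpace Ω] (P : Measure Ω) [IsProbabilityMeasure P]
    (X : Ω → ℝ) : Monotone (cdfOf P X) := by
  intro x y hxy
  unfold cdfOf
  exact ENNReal.toReal_mono (measure_ne_top _ _) (measure_mono fun ω h => le_trans h hxy)

lemma aux_lt {Ω : Type*} [MeasurableSpace Ω] (P : Measure Ω) [IsProbabilityMeasure P]
    (X : Ω → ℝ) (hX : Measurable X) (hc : Continuous (cdfOf P X)) :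
    lowerEnd (cdfOf P X) < upperEnd (cdfOf P X) := by
  have hm := aux_mono P X
  have heq : ∀ x, cdfOf P X x = ProbabilityTheory.cdf (P.map X) x := by
    intro x
    haveI : IsProbabilityMeasure (P.map X) := Measure.isProbabilityMeasure_map hX.aemeasurable
    rw [ProbabilityTheory.cdf_eq_real, Measure.real, Measure.map_apply hX measurableSet_Iic]
    rfl
  have h1 : Tendsto (cdfOf P X) atTop (nhds 1) := by
    rw [funext heq]; exact ProbabilityTheory.tendsto_cdf_atTop _
  have h0 : Tendsto (cdfOf P X) atBot (nhds 0) := by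
    rw [funext heq]; exact ProbabilityTheory.tendsto_cdf_atBot _
  have key : ∀ c : ℝ, 0 < c → c < 1 → ∃ x, cdfOf P X x = c := by
    intro c hc0 hc1
    obtain ⟨x, hx⟩ := (h0.eventually (eventually_lt_nhds hc0)).exists
    obtain ⟨y, hy⟩ := (h1.eventually (eventually_gt_nhds hc1)).exists
    exact mem_range_of_exists_le_of_exists_ge hc ⟨x, hx.le⟩ ⟨y, hy.le⟩
  obtain ⟨x, hx⟩ := key (1/3) (by norm_num) (by norm_num)
  obtain ⟨y, hy⟩ := key (2/3) (by norm_num) (by norm_num)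
  have hxy : x < y := by
    by_contra h
    have := hm (not_lt.1 h)
    rw [hx, hy] at this; norm_num at this
  have ha : lowerEnd (cdfOf P X) ≤ (x : EReal) := by
    apply sSup_le
    rintro _ ⟨z, hz, rfl⟩
    by_contra h
    have h' : x < z := by simpa using h
    have := hm h'.le
    rw [hx, show cdfOf P X z = 0 from hz] at this; norm_num at this
  have hb : (y : EReal) ≤ upperEnd (cdfOf P X) := by
    apply le_sInf
    rintro _ ⟨z, hz, rfl⟩
    by_contra h
    have h' : z < y := by simpa using h
    have := hm h'.le
    rw [hy, show cdfOf P X z = 1 from hz] at this; norm_num at this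
  exact ha.trans_lt ((EReal.coe_lt_coe_iff.2 hxy).trans_le hb)

lemma aux_supp {Ω : Type*} [MeasurableSpace Ω] (P : Measure Ω) [IsProbabilityMeasure P]
    (X : Ω → ℝ) (hX : Measurable X) :
    ∀ᵐ ω ∂P, lowerEnd (cdfOf P X) ≤ (X ω : EReal) ∧ (X ω : EReal) ≤ upperEnd (cdfOf P X) := by
  have hm := aux_mono P X
  have h1 : ∀ᵐ ω ∂P, ∀ q : ℚ, cdfOf P X q = 0 → (q : ℝ) < X ω := by
    rw [ae_all_iff]
    intro q
    by_cases hq : cdfOf P X q = 0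
    · have : P {ω | X ω ≤ q} = 0 := by
        rcases (ENNReal.toReal_eq_zero_iff _).1 hq with h | h
        · exact h
        · exact absurd h (measure_ne_top _ _)
      have h2 : ∀ᵐ ω ∂P, ¬ X ω ≤ q := by
        rw [ae_iff]; simpa using this
      filter_upwards [h2] with ω h _
      exact not_le.1 h
    · exact Eventually.of_forall fun ω h => absurd h hq
  have h2 : ∀ᵐ ω ∂P, ∀ q : ℚ, cdfOf P X q = 1 → X ω ≤ (q : ℝ) := by
    rw [ae_all_iff]
    intro q
    by_cases hq : cdfOf P X q = 1
    · have : P {ω | X ω ≤ q} = 1 := by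
        have := (ENNReal.toReal_eq_one_iff _).1 hq
        exact this
      have h3 := (prob_compl_eq_zero_iff (measurableSet_le hX measurable_const)).2 this
      filter_upwards [mem_ae_iff.2 h3] with ω h _
      exact h
    · exact Eventually.of_forall fun ω h => absurd h hq
  filter_upwards [h1, h2] with ω ha hb
  constructor
  · apply sSup_le
    rintro _ ⟨z, hz, rfl⟩
    by_contra h
    have h' : X ω < z := by simpa using h
    obtain ⟨q, hq1, hq2⟩ := exists_rat_btwn h'
    have h3 : cdfOf P X q ≤ 0 := (hm hq2.le).trans_eq hz
    have := ha q (le_antisymm h3 ENNReal.toReal_nonneg)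
    linarith
  · apply le_sInf
    rintro _ ⟨z, hz, rfl⟩
    by_contra h
    have h' : z < X ω := by simpa using h
    obtain ⟨q, hq1, hq2⟩ := exists_rat_btwn h'
    have h3 : 1 ≤ cdfOf P X q := hz.symm.trans_le (hm hq1.le)
    have h4 : cdfOf P X q ≤ 1 := by
      unfold cdfOf
      exact ENNReal.toReal_le_of_le_ofReal zero_le_one (by simpa using prob_le_one)
    have := hb q (le_antisymm h4 h3)
    linarith

lemma aux_stat {Ω : Type*} [MeasurableSpace Ω] (P : Measure Ω)
    (X : ℕ → Ω → ℝ) (hmeas : ∀ t, Measurable (X t)) (hss : StrictlyStationary P X) (t : ℕ) :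
    cdfOf P (X (1 + t)) = cdfOf P (X 1) := by
  funext x
  have h := hss 1 t
  have h2 := congrArg (fun m => m {f : Fin 1 → ℝ | f 0 ≤ x}) h
  have hS : MeasurableSet {f : Fin 1 → ℝ | f 0 ≤ x} :=
    measurableSet_le (measurable_pi_apply 0) measurable_const
  rw [Measure.map_apply (measurable_pi_lambda _ fun i => hmeas _) hS,
    Measure.map_apply (measurable_pi_lambda _ fun i => hmeas _) hS] at h2
  exact congrArg ENNReal.toReal h2

lemma aux_choose (a b : EReal) (hab : a < b) (g : ℝ → ℝ)
    (hg : IntegrableOn g {x : ℝ | a ≤ (x : EReal) ∧ (x : EReal) ≤ b})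
    (ε : ℝ) (hε : 0 < ε) :
    ∃ u v : ℝ, a < u ∧ (u : EReal) < b ∧ a < v ∧ (v : EReal) < b ∧
      ∫ x in {x : ℝ | a ≤ (x : EReal) ∧ (x : EReal) ≤ b} \ Set.Icc u v, g x < ε := by
  obtain ⟨p, hpm, hp, hpt⟩ := exists_seq_strictMono_tendsto' hab
  obtain ⟨q, hqm, hq, hqt⟩ := exists_seq_strictAnti_tendsto' hab
  have hpr : ∀ n, ((p n).toReal : EReal) = p n := fun n =>
    EReal.coe_toReal ((hp n).2.trans_le le_top).ne (bot_le.trans_lt (hp n).1).ne'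
  have hqr : ∀ n, ((q n).toReal : EReal) = q n := fun n =>
    EReal.coe_toReal ((hq n).2.trans_le le_top).ne (bot_le.trans_lt (hq n).1).ne'
  set S := {x : ℝ | a ≤ (x : EReal) ∧ (x : EReal) ≤ b} with hS
  have hSm : MeasurableSet S :=
    (measurableSet_le measurable_const measurable_coe_real_ereal).inter
      (measurableSet_le measurable_coe_real_ereal measurable_const)
  let T : ℕ → Set ℝ := fun n => S \ Set.Icc (q n).toReal (p n).toReal
  have hT : Antitone T := by
    intro m n hmn
    apply Set.diff_subset_diff_right
    apply Set.Icc_subset_Icc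
    · rw [← EReal.coe_le_coe_iff, hqr, hqr]; exact hqm.antitone hmn
    · rw [← EReal.coe_le_coe_iff, hpr, hpr]; exact hpm.monotone hmn
  have hlim := tendsto_setIntegral_of_antitone (μ := volume) (f := g) (s := T)
    (fun n => hSm.diff measurableSet_Icc) hT ⟨0, hg.mono_set Set.diff_subset⟩
  have hsub : (⋂ n, T n) ⊆ {a.toReal, b.toReal} := by
    intro x hx
    rw [Set.mem_iInter] at hx
    have hxS : x ∈ S := (hx 0).1
    by_contra hne
    have hxa : a < (x : EReal) := lt_of_le_of_ne hxS.1 (by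
      rintro rfl; simp at hne)
    have hxb : (x : EReal) < b := lt_of_le_of_ne hxS.2 (by
      rintro rfl; simp at hne)
    obtain ⟨n, hn1, hn2⟩ := ((hpt.eventually (eventually_gt_nhds hxb)).and
      (hqt.eventually (eventually_lt_nhds hxa))).exists
    apply (hx n).2
    constructor
    · rw [← EReal.coe_le_coe_iff, hqr]; exact hn2.le
    · rw [← EReal.coe_le_coe_iff, hpr]; exact hn1.le
  have hz : volume (⋂ n, T n) = 0 :=
    measure_mono_null hsub (Set.Finite.measure_zero (Set.toFinite _) _)
  rw [setIntegral_measure_zero _ hz] at hlim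
  obtain ⟨n, hn⟩ := (hlim.eventually (eventually_lt_nhds hε)).exists
  exact ⟨(q n).toReal, (p n).toReal, by rw [hqr]; exact (hq n).1, by rw [hqr]; exact (hq n).2,
    by rw [hpr]; exact (hp n).1, by rw [hpr]; exact (hp n).2, hn⟩

theorem stmt_3 {Ω : Type*} [MeasurableSpace Ω] (P : Measure Ω) [IsProbabilityMeasure P]
    (X : ℕ → Ω → ℝ) (hmeas : ∀ t, Measurable (X t))
    (hss : StrictlyStationary P X)
    (hcont : Continuous (cdfOf P (X 1)))
    (htd : TemperatelyDependent P X (cdfOf P (X 1)))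
    (h0 h0star : ℝ → ℝ) (hmeas0 : Measurable h0star)
    (hAC : ∀ u v : ℝ, u ≤ v →
      lowerEnd (cdfOf P (X 1)) ≤ (u : EReal) → (v : EReal) ≤ upperEnd (cdfOf P (X 1)) →
      h0 v - h0 u = ∫ x in Set.Icc u v, h0star x)
    (hint : IntegrableOn (fun x => |h0star x|)
      {x : ℝ | lowerEnd (cdfOf P (X 1)) ≤ (x : EReal) ∧
        (x : EReal) ≤ upperEnd (cdfOf P (X 1))} volume) :
    TendstoInProb P (fun n ω => h0 (rmax X n ω) - h0 (rmin X n ω))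
      (∫ x in {x : ℝ | lowerEnd (cdfOf P (X 1)) ≤ (x : EReal) ∧
        (x : EReal) ≤ upperEnd (cdfOf P (X 1))}, h0star x) := by
  have hab := aux_lt P (X 1) (hmeas 1) hcont
  have hsupp : ∀ᵐ ω ∂P, ∀ t : ℕ, lowerEnd (cdfOf P (X 1)) ≤ (X (1 + t) ω : EReal) ∧
      (X (1 + t) ω : EReal) ≤ upperEnd (cdfOf P (X 1)) := by
    rw [ae_all_iff]
    intro t
    have := aux_supp P (X (1 + t)) (hmeas _)
    rwa [aux_stat P X hmeas hss t] at this
  unfold TemperatelyDependent at htd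
  generalize lowerEnd (cdfOf P (X 1)) = a at *
  generalize upperEnd (cdfOf P (X 1)) = b at *
  intro ε hε
  obtain ⟨u, v, hau, hub, hav, hvb, hlt⟩ := aux_choose a b hab _ hint ε hε
  have hlim := ((htd u hau hub).1).add ((htd v hav hvb).2)
  rw [add_zero] at hlim
  set S := {x : ℝ | a ≤ (x : EReal) ∧ (x : EReal) ≤ b} with hS
  have hi : IntegrableOn h0star S :=
    (integrable_norm_iff hmeas0.aestronglyMeasurable).1 hint
  refine tendsto_of_tendsto_of_tendsto_of_le_of_le tendsto_const_nhds hlim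
    (fun n => zero_le) (fun n => ?_)
  refine le_trans (measure_mono_ae ?_) (measure_union_le _ _)
  filter_upwards [hsupp] with ω hω hbad
  by_contra hcon
  have hcon' : ¬ (u ≤ rmin X n ω) ∧ ¬ (rmax X n ω ≤ v) := not_or.1 hcon
  obtain ⟨h1, h2⟩ := hcon'
  rw [not_le] at h1 h2
  have hrange : ∀ t ∈ Finset.Icc 1 (max n 1), a ≤ (X t ω : EReal) ∧ (X t ω : EReal) ≤ b := by
    intro t ht
    have h := hω (t - 1)
    rwa [Nat.add_sub_cancel' (Finset.mem_Icc.1 ht).1] at h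
  have hmin : a ≤ (rmin X n ω : EReal) := by
    obtain ⟨t, ht, he⟩ := Finset.exists_mem_eq_inf'
      (Finset.nonempty_Icc.mpr (le_max_right n 1)) (fun t => X t ω)
    unfold rmin
    rw [he]; exact (hrange t ht).1
  have hmax : (rmax X n ω : EReal) ≤ b := by
    obtain ⟨t, ht, he⟩ := Finset.exists_mem_eq_sup'
      (Finset.nonempty_Icc.mpr (le_max_right n 1)) (fun t => X t ω)
    unfold rmax
    rw [he]; exact (hrange t ht).2
  have hle : rmin X n ω ≤ rmax X n ω := by
    have hmem : 1 ∈ Finset.Icc 1 (max n 1) := Finset.mem_Icc.2 ⟨le_rfl, le_max_right n 1⟩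
    exact (Finset.inf'_le (fun t => X t ω) hmem).trans (Finset.le_sup' (fun t => X t ω) hmem)
  have hbad' : ε ≤ |h0 (rmax X n ω) - h0 (rmin X n ω) - ∫ x in S, h0star x| := hbad
  rw [hAC _ _ hle hmin hmax] at hbad'
  have hsub : Set.Icc (rmin X n ω) (rmax X n ω) ⊆ S := fun x hx =>
    ⟨hmin.trans (EReal.coe_le_coe_iff.2 hx.1), (EReal.coe_le_coe_iff.2 hx.2).trans hmax⟩
  have hd := integral_diff (μ := volume) (f := h0star) measurableSet_Icc hi hsub
  have hSm : MeasurableSet S :=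
    (measurableSet_le measurable_const measurable_coe_real_ereal).inter
      (measurableSet_le measurable_coe_real_ereal measurable_const)
  rw [abs_sub_comm, ← hd] at hbad'
  have h3 : |∫ x in S \ Set.Icc (rmin X n ω) (rmax X n ω), h0star x| ≤
      ∫ x in S \ Set.Icc (rmin X n ω) (rmax X n ω), |h0star x| := abs_integral_le_integral_abs
  have h4 : ∫ x in S \ Set.Icc (rmin X n ω) (rmax X n ω), |h0star x| ≤
      ∫ x in S \ Set.Icc u v, |h0star x| :=
    setIntegral_mono_set (hint.mono_set Set.diff_subset)
      (Eventually.of_forall fun x => abs_nonneg _)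
      (Set.diff_subset_diff_right (Set.Icc_subset_Icc h1.le h2.le)).eventuallyLE
  linarith
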